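/- arXiv:2402.15898 — 4 statements merged into one kernel-verified Lean document; each statement's English description precedes it below -/
import Mathlib

section
/- Let S be a finite type and let F : Finset S → ℝ be non-negative, monotone, and submodular. Let x_1, x_2, … be a greedy sequence for F, i.e., for every i ≥ 0 the element x_{i+1} maximizes y ↦ F({x_1,…,x_i} ∪ {y}) over y ∈ S. Then for every n ≥ 1, F({x_1,…,x_n}) ≥ (1 − 1/e) · max_{X ⊆ S, |X| ≤ n} F(X). -/
/-- For a submodular set function, adding a set `X` to `A` gains at most `#X` times
any bound on the marginal gain of a single element at `A`. -/
theorem submodular_union_sub_le_card_mul {S : Type*} [DecidableEq S] {F : Finset S → ℝ}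
    (hsubmod : ∀ (x : S) (X' X : Finset S), X' ⊆ X →
      F (insert x X) - F X ≤ F (insert x X') - F X')
    {A : Finset S} {d : ℝ} (hd : ∀ y, F (insert y A) - F A ≤ d) (X : Finset S) :
    F (X ∪ A) - F A ≤ X.card * d := by
  induction X using Finset.induction_on with
  | empty => simp
  | insert a X ha ih =>
    rw [Finset.insert_union, Finset.card_insert_of_notMem ha]
    push_cast
    linarith [hsubmod a A (X ∪ A) Finset.subset_union_right, hd a]

/-- Along a greedy sequence, the gap to the value of a set of at most `n` elements
contracts by a factor `1 - 1 / n` at every step. -/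
theorem greedy_gap_le_pow_mul {S : Type*} [DecidableEq S] {F : Finset S → ℝ}
    (hnonneg : ∀ X : Finset S, 0 ≤ F X)
    (hmono : ∀ X' X : Finset S, X' ⊆ X → F X' ≤ F X)
    (hsubmod : ∀ (x : S) (X' X : Finset S), X' ⊆ X →
      F (insert x X) - F X ≤ F (insert x X') - F X')
    {x : ℕ → S}
    (hgreedy : ∀ (i : ℕ) (y : S),
      F (insert y ((Finset.range i).image x)) ≤ F (insert (x i) ((Finset.range i).image x)))
    {n : ℕ} (hn : 1 ≤ n) {X : Finset S} (hX : X.card ≤ n) (i : ℕ) :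
    F X - F ((Finset.range i).image x) ≤ (1 - 1 / (n : ℝ)) ^ i * F X := by
  have hn' : (1 : ℝ) ≤ n := by exact_mod_cast hn
  have hn0 : (0 : ℝ) < n := by linarith
  induction i with
  | zero => simpa using hnonneg ∅
  | succ i ih =>
    rw [Finset.range_add_one, Finset.image_insert, pow_succ']
    set A := (Finset.range i).image x
    have hgain : F X - F A ≤ n * (F (insert (x i) A) - F A) :=
      calc F X - F A ≤ F (X ∪ A) - F A := by
            linarith [hmono X (X ∪ A) Finset.subset_union_left]
        _ ≤ X.card * (F (insert (x i) A) - F A) :=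
            submodular_union_sub_le_card_mul hsubmod
              (fun y => sub_le_sub_right (hgreedy i y) _) X
        _ ≤ n * (F (insert (x i) A) - F A) :=
            mul_le_mul_of_nonneg_right (by exact_mod_cast hX)
              (sub_nonneg.2 (hmono _ _ (Finset.subset_insert _ _)))
    have hstep : (F X - F A) / n ≤ F (insert (x i) A) - F A := by
      rwa [div_le_iff₀' hn0]
    have hfactor : 0 ≤ 1 - 1 / (n : ℝ) := by
      rw [sub_nonneg, div_le_one hn0]
      exact hn'
    calc F X - F (insert (x i) A) ≤ (1 - 1 / (n : ℝ)) * (F X - F A) := by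
          rw [sub_mul, one_mul, one_div_mul_eq_div]
          linarith
      _ ≤ (1 - 1 / (n : ℝ)) * ((1 - 1 / (n : ℝ)) ^ i * F X) :=
          mul_le_mul_of_nonneg_left ih hfactor
      _ = _ := by ring

/-- Nemhauser–Wolsey–Fisher constant-factor guarantee for greedy maximization of a
non-negative, monotone, submodular set function: for every `n ≥ 1`, the value of the
greedily selected set of `n` elements is at least `(1 - 1/e)` times the value of any
set of cardinality at most `n`. -/
theorem greedy_submodular_guarantee {S : Type*} [Fintype S] [DecidableEq S]
    (F : Finset S → ℝ)
    (hnonneg : ∀ X : Finset S, 0 ≤ F X)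
    (hmono : ∀ X' X : Finset S, X' ⊆ X → F X' ≤ F X)
    (hsubmod : ∀ (x : S) (X' X : Finset S), X' ⊆ X →
      F (insert x X) - F X ≤ F (insert x X') - F X')
    (x : ℕ → S)
    (hgreedy : ∀ (i : ℕ) (y : S),
      F (insert y ((Finset.range i).image x)) ≤ F (insert (x i) ((Finset.range i).image x)))
    (n : ℕ) (hn : 1 ≤ n) (X : Finset S) (hX : X.card ≤ n) :
    (1 - 1 / Real.exp 1) * F X ≤ F ((Finset.range n).image x) := by
  have hgap := greedy_gap_le_pow_mul hnonneg hmono hsubmod hgreedy hn hX n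
  have hexp : (1 - 1 / (n : ℝ)) ^ n ≤ 1 / Real.exp 1 := by
    have h := Real.one_sub_div_pow_le_exp_neg (n := n) (t := 1) (by exact_mod_cast hn)
    rwa [Real.exp_neg, ← one_div] at h
  linarith [mul_le_mul_of_nonneg_right hexp (hnonneg X)]
end

section
/- Let S be a finite type, F : Finset S → ℝ a monotone, non-negative set function with F(∅) = 0, and let x_1, …, x_n be a greedy sequence for F. Let κ > 0 be such that for every D ⊆ {x_1,…,x_n} and every X ⊆ S with |X| ≤ n and D ∩ X = ∅, one has Σ_{x ∈ X} (F(D ∪ {x}) − F(D)) ≥ κ · (F(D ∪ X) − F(D)). Then F({x_1,…,x_n}) ≥ (1 − exp(−κ)) · max_{X ⊆ S, |X| ≤ n} F(X). -/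
/-- If every one-element extension of `D` has value at most `m`, then the shortfall of `D` from a set
`X` of at most `n` elements is controlled by `n` times the gain `m - F D`. -/
theorem weak_submodular_gap_le {S : Type*} [DecidableEq S] {F : Finset S → ℝ}
    (hmono : ∀ X' X : Finset S, X' ⊆ X → F X' ≤ F X) {n : ℕ} {κ m : ℝ} (hκ : 0 ≤ κ)
    {D X : Finset S} (hX : X.card ≤ n)
    (hweak : κ * (F (D ∪ X \ D) - F D) ≤ ∑ z ∈ X \ D, (F (insert z D) - F D))
    (hD : F D ≤ m) (hm : ∀ y, F (insert y D) ≤ m) :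
    κ * (F X - F D) ≤ n * (m - F D) := by
  have hcard : ((X \ D).card : ℝ) ≤ n :=
    mod_cast (Finset.card_le_card Finset.sdiff_subset).trans hX
  calc κ * (F X - F D) ≤ κ * (F (D ∪ X \ D) - F D) := by
        gcongr
        exact hmono _ _ (by simp)
    _ ≤ ∑ z ∈ X \ D, (F (insert z D) - F D) := hweak
    _ ≤ (X \ D).card * (m - F D) := by
        rw [← nsmul_eq_mul]
        exact Finset.sum_le_card_nsmul _ _ _ fun y _ => sub_le_sub_right (hm y) _
    _ ≤ n * (m - F D) := mul_le_mul_of_nonneg_right hcard (sub_nonneg.2 hD)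

/-- A nonincreasing sequence that loses at least the fraction `c` of its value at each step
decays exponentially. -/
theorem le_exp_neg_mul_of_mul_le_sub {a : ℕ → ℝ} {n : ℕ} {c b : ℝ} (hb : 0 ≤ b) (h0 : a 0 ≤ b)
    (hanti : ∀ i < n, a (i + 1) ≤ a i) (hstep : ∀ i < n, c * a i ≤ a i - a (i + 1)) :
    ∀ i ≤ n, a i ≤ Real.exp (-(c * i)) * b := by
  intro i
  induction i with
  | zero => simpa using h0
  | succ i ih =>
    intro hi
    rcases le_total (a i) 0 with hneg | hpos
    · exact ((hanti i hi).trans hneg).trans (by positivity)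
    · calc a (i + 1) ≤ (-c + 1) * a i := by linarith [hstep i hi]
        _ ≤ Real.exp (-c) * a i := mul_le_mul_of_nonneg_right (Real.add_one_le_exp _) hpos
        _ ≤ Real.exp (-c) * (Real.exp (-(c * i)) * b) := by
          gcongr
          exact ih (by omega)
        _ = Real.exp (-(c * (i + 1 : ℕ))) * b := by
          rw [← mul_assoc, ← Real.exp_add]
          push_cast
          ring_nf


/-- Das–Kempe approximate guarantee for greedy maximization of a non-negative, monotone
set function with submodularity ratio at least `κ` up to cardinality `n`: the value of the
greedily selected set of `n` elements is at least `(1 - exp (-κ))` times the value of any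
set of cardinality at most `n`. -/
theorem greedy_weakly_submodular_guarantee {S : Type*} [Fintype S] [DecidableEq S]
    (F : Finset S → ℝ)
    (hnonneg : ∀ X : Finset S, 0 ≤ F X)
    (hmono : ∀ X' X : Finset S, X' ⊆ X → F X' ≤ F X)
    (hempty : F ∅ = 0)
    (n : ℕ) (x : ℕ → S)
    (hgreedy : ∀ i < n, ∀ y : S,
      F (insert y ((Finset.range i).image x)) ≤ F (insert (x i) ((Finset.range i).image x)))
    (κ : ℝ) (hκ : 0 < κ)
    (hweak : ∀ D : Finset S, D ⊆ (Finset.range n).image x →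
      ∀ X : Finset S, X.card ≤ n → Disjoint D X →
        κ * (F (D ∪ X) - F D) ≤ ∑ z ∈ X, (F (insert z D) - F D))
    (X : Finset S) (hX : X.card ≤ n) :
    (1 - Real.exp (-κ)) * F X ≤ F ((Finset.range n).image x) := by
  rcases n.eq_zero_or_pos with rfl | hn
  · obtain rfl : X = ∅ := by simpa using hX
    simp [hempty]
  have hn' : (0 : ℝ) < n := mod_cast hn
  have hsucc (i : ℕ) :
      (Finset.range (i + 1)).image x = insert (x i) ((Finset.range i).image x) := by
    rw [Finset.range_add_one, Finset.image_insert]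
  have hinc (i : ℕ) :
      F ((Finset.range i).image x) ≤ F (insert (x i) ((Finset.range i).image x)) :=
    hmono _ _ (Finset.subset_insert _ _)
  have hdecay := le_exp_neg_mul_of_mul_le_sub
    (a := fun i => F X - F ((Finset.range i).image x)) (n := n) (c := κ / n) (hnonneg X)
    (by simp [hempty])
    (fun i _ => by simpa only [hsucc] using sub_le_sub_left (hinc i) (F X))
    (fun i hi => by
      have hgap := weak_submodular_gap_le hmono hκ.le hX
        (hweak _ (Finset.image_subset_image (Finset.range_subset_range.2 hi.le)) _
          ((Finset.card_le_card Finset.sdiff_subset).trans hX) Finset.disjoint_sdiff)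
        (hinc i) (hgreedy i hi)
      rw [hsucc, div_mul_eq_mul_div, div_le_iff₀ hn']
      linarith)
    n le_rfl
  rw [div_mul_cancel₀ κ hn'.ne'] at hdecay
  linarith
end

section
/- Let A be a positive definite real n × n matrix and let D be the diagonal matrix whose diagonal entries are those of A. Then A ⪯ n·D in the Loewner order, i.e., the matrix n·D − A is positive semidefinite. -/
open Matrix

theorem Matrix.PosSemidef.two_mul_mul_apply_mul_le {ι : Type*} [Fintype ι] [DecidableEq ι]
    {A : Matrix ι ι ℝ} (hA : A.PosSemidef) (x : ι → ℝ) (i j : ι) :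
    2 * (x i * A i j * x j) ≤ x i * A i i * x i + x j * A j j * x j := by
  have h := hA.dotProduct_mulVec_nonneg (Pi.single i (x i) - Pi.single j (x j))
  have hs : A j i = A i j := by simpa using hA.isHermitian.apply i j
  simp only [star_trivial, mulVec_sub, dotProduct_sub, sub_dotProduct, single_dotProduct,
    mulVec_single, Pi.smul_apply, col_apply, MulOpposite.smul_eq_mul_unop,
    MulOpposite.unop_op, hs] at h
  linarith

/-- If `A` is a positive definite real `n × n` matrix and `D` is the diagonal matrix with
the same diagonal as `A`, then `A ⪯ n • D` in the Loewner order, i.e. `n • D - A` is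
positive semidefinite. -/
theorem posDef_le_card_smul_diagonal {n : ℕ} (A : Matrix (Fin n) (Fin n) ℝ)
    (hA : A.PosDef) :
    ((n : ℝ) • Matrix.diagonal (fun i => A i i) - A).PosSemidef := by
  have hD : ((n : ℝ) • Matrix.diagonal (fun i => A i i)).IsHermitian := by
    rw [← diagonal_smul]
    exact isHermitian_diagonal _
  refine .of_dotProduct_mulVec_nonneg (hD.sub hA.isHermitian) fun x => ?_
  have h := Finset.sum_le_sum fun i (_ : i ∈ Finset.univ) =>
    Finset.sum_le_sum fun j (_ : j ∈ Finset.univ) =>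
      hA.posSemidef.two_mul_mul_apply_mul_le x i j
  simp only [Finset.sum_add_distrib, Finset.sum_const, Finset.card_univ, Fintype.card_fin,
    nsmul_eq_mul, ← Finset.mul_sum] at h
  have hq : x ⬝ᵥ (A *ᵥ x) = ∑ i, ∑ j, x i * A i j * x j := by
    simp only [dotProduct, mulVec, Finset.mul_sum, mul_assoc]
  have hd : x ⬝ᵥ (diagonal (fun i => A i i) *ᵥ x) = ∑ i, x i * A i i * x i := by
    simp only [dotProduct, mulVec_diagonal, mul_assoc]
  rw [star_trivial, sub_mulVec, dotProduct_sub, smul_mulVec, dotProduct_smul, smul_eq_mul, hq, hd]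
  linarith
end

section
/- Let K be a positive definite real d × d matrix, let μ > 0 be such that K − μ·I is positive semidefinite (i.e., all eigenvalues of K are at least μ), let Σ be a positive semidefinite real d × d matrix whose diagonal entries satisfy Σ_{ii} ≤ ε for all i (with ε ≥ 0), let k ∈ ℝ^d, and set z := K⁻¹k. Then zᵀ Σ z ≤ (ε · d / μ) · (kᵀ K⁻¹ k). -/
open Matrix

namespace Matrix.PosSemidef

variable {n : Type*} [Fintype n] [DecidableEq n] {M : Matrix n n ℝ}

theorem two_mul_apply_mul_le (hM : M.PosSemidef) (z : n → ℝ) (i j : n) :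
    2 * (z i * (M i j * z j)) ≤ M i i * z i ^ 2 + M j j * z j ^ 2 := by
  have h := hM.dotProduct_mulVec_nonneg (Pi.single i (z i) - Pi.single j (z j))
  have hsymm : M j i = M i j := by simpa using hM.isHermitian.apply i j
  simp only [star_trivial, mulVec_sub, sub_dotProduct, dotProduct_sub, single_dotProduct,
    mulVec_single, Pi.smul_apply, col_apply, MulOpposite.smul_eq_mul_unop,
    MulOpposite.unop_op, hsymm] at h
  linarith

theorem dotProduct_mulVec_le_card_mul (hM : M.PosSemidef) {ε : ℝ} (hdiag : ∀ i, M i i ≤ ε)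
    (z : n → ℝ) : z ⬝ᵥ (M *ᵥ z) ≤ ε * Fintype.card n * (z ⬝ᵥ z) := by
  have hpair (i j : n) : z i * (M i j * z j) ≤ ε / 2 * (z i ^ 2 + z j ^ 2) := by
    have h := hM.two_mul_apply_mul_le z i j
    have hi := mul_le_mul_of_nonneg_right (hdiag i) (sq_nonneg (z i))
    have hj := mul_le_mul_of_nonneg_right (hdiag j) (sq_nonneg (z j))
    linarith
  calc z ⬝ᵥ (M *ᵥ z) = ∑ i, ∑ j, z i * (M i j * z j) := by
        simp only [dotProduct, mulVec, Finset.mul_sum]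
    _ ≤ ∑ i, ∑ j, ε / 2 * (z i ^ 2 + z j ^ 2) :=
        Finset.sum_le_sum fun i _ => Finset.sum_le_sum fun j _ => hpair i j
    _ = ε * Fintype.card n * (z ⬝ᵥ z) := by
        simp only [← Finset.mul_sum, Finset.sum_add_distrib, Finset.sum_const, Finset.card_univ,
          nsmul_eq_mul, dotProduct, ← pow_two]
        ring

theorem mul_dotProduct_self_le {μ : ℝ} (hM : (M - μ • (1 : Matrix n n ℝ)).PosSemidef)
    (z : n → ℝ) : μ * (z ⬝ᵥ z) ≤ z ⬝ᵥ (M *ᵥ z) := by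
  have h := hM.dotProduct_mulVec_nonneg z
  simp only [star_trivial, sub_mulVec, smul_mulVec, one_mulVec, dotProduct_sub, dotProduct_smul,
    smul_eq_mul] at h
  linarith

end Matrix.PosSemidef

/-- Quadratic-form bound: if `K` is positive definite with all eigenvalues at least `μ > 0`
(i.e. `K - μ • 1` is positive semidefinite), `C` is positive semidefinite with all diagonal
entries at most `ε`, and `z = K⁻¹ k`, then `zᵀ C z ≤ (ε d / μ) (kᵀ K⁻¹ k)`. -/
theorem quadratic_form_bound {d : ℕ} (K : Matrix (Fin d) (Fin d) ℝ) (hK : K.PosDef)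
    (μ : ℝ) (hμ : 0 < μ) (hKμ : (K - μ • (1 : Matrix (Fin d) (Fin d) ℝ)).PosSemidef)
    (C : Matrix (Fin d) (Fin d) ℝ) (hC : C.PosSemidef)
    (ε : ℝ) (hε : 0 ≤ ε) (hdiag : ∀ i, C i i ≤ ε)
    (k : Fin d → ℝ) :
    (K⁻¹ *ᵥ k) ⬝ᵥ (C *ᵥ (K⁻¹ *ᵥ k)) ≤ (ε * d / μ) * (k ⬝ᵥ (K⁻¹ *ᵥ k)) := by
  have hKz : K *ᵥ (K⁻¹ *ᵥ k) = k := by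
    rw [mulVec_mulVec, mul_nonsing_inv _ ((isUnit_iff_isUnit_det K).mp hK.isUnit), one_mulVec]
  have hlow := PosSemidef.mul_dotProduct_self_le hKμ (K⁻¹ *ᵥ k)
  rw [hKz, dotProduct_comm _ k] at hlow
  have hup := hC.dotProduct_mulVec_le_card_mul hdiag (K⁻¹ *ᵥ k)
  rw [Fintype.card_fin] at hup
  calc _ ≤ ε * d * ((K⁻¹ *ᵥ k) ⬝ᵥ (K⁻¹ *ᵥ k)) := hup
    _ = ε * d / μ * (μ * ((K⁻¹ *ᵥ k) ⬝ᵥ (K⁻¹ *ᵥ k))) := by field_simp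
    _ ≤ ε * d / μ * (k ⬝ᵥ (K⁻¹ *ᵥ k)) := by gcongr
end
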